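/- arXiv:2209.01616 — 4 statements merged into one kernel-verified Lean document; each statement's English description precedes it below -/
import Mathlib

section
/- There exists a constant C > 0 such that for every integer n ≥ 2 and every x ∈ [−π, π], ∫_{−π}^{π} L_n(x−y) L_n(y) dy ≤ C·L_n(x)·log n. -/
open MeasureTheory Real Filter Asymptotics Set Finset Topology

noncomputable section

/-- `Π₀ = [-π,π] \ {0}`. -/
def Pi0 : Set ℝ := Set.Icc (-Real.pi) Real.pi \ {0}

/-- Membership in `F_α`: integrable on `Π` with `sup_{x ∈ Π₀} |x|^α |f(x)| < ∞`. -/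
def MemF (a : ℝ) (f : ℝ → ℝ) : Prop :=
  MeasureTheory.IntegrableOn f (Set.Icc (-Real.pi) Real.pi) ∧
    ∃ M : ℝ, ∀ x ∈ Pi0, |x| ^ a * |f x| ≤ M

/-- Membership in `F_α^{(1)}`: in `F_α`, continuously differentiable on `Π₀`,
with `sup_{x ∈ Π₀} |x|^{α+1} |f'(x)| < ∞`. -/
def MemF1 (a : ℝ) (f : ℝ → ℝ) : Prop :=
  MemF a f ∧
    ∃ f' : ℝ → ℝ, ContinuousOn f' Pi0 ∧
      (∀ x ∈ Pi0, HasDerivWithinAt f (f' x) Pi0 x) ∧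
      ∃ M : ℝ, ∀ x ∈ Pi0, |x| ^ (a + 1) * |f' x| ≤ M

/-- `τ`-th Fourier coefficient `∫_Π e^{iτx} f(x) dx`. -/
def fourierCoef (f : ℝ → ℝ) (τ : ℤ) : ℂ :=
  ∫ x in Set.Icc (-Real.pi) Real.pi, Complex.exp (Complex.I * (τ : ℂ) * (x : ℂ)) * (f x : ℂ)

/-- `n × n` Toeplitz matrix with `(i,j)` entry `f̂(i - j)`. -/
def Toep (n : ℕ) (f : ℝ → ℝ) : Matrix (Fin n) (Fin n) ℂ :=
  Matrix.of fun i j : Fin n => fourierCoef f ((i : ℤ) - (j : ℤ))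

/-- `D_n(x) = ∑_{t=1}^n e^{itx}`. -/
def Dn (n : ℕ) (x : ℝ) : ℂ :=
  ∑ t ∈ Finset.range n, Complex.exp (Complex.I * ((t : ℂ) + 1) * (x : ℂ))

/-- `L_n(x) = min(|x|⁻¹, n)` for `x ≠ 0`, and `L_n(0) = n`. -/
def Ln (n : ℕ) (x : ℝ) : ℝ := if x = 0 then (n : ℝ) else min |x|⁻¹ (n : ℝ)

/-- partial sum `x̄_j = x_1 + ⋯ + x_j` (with `x` indexed from `0`). -/
def psum {m : ℕ} (x : Fin m → ℝ) (j : ℕ) : ℝ :=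
  ∑ k ∈ Finset.range j, if h : k < m then x ⟨k, h⟩ else 0

/-- the coordinate `x_{j+1}` (zero-based index `j`), defaulting to `0` out of range. -/
def xval {m : ℕ} (x : Fin m → ℝ) (j : ℕ) : ℝ := if h : j < m then x ⟨j, h⟩ else 0

/-- the cube `Π^m = [-π,π]^m`. -/
def PiBox (m : ℕ) : Set (Fin m → ℝ) := Set.pi Set.univ fun _ => Set.Icc (-Real.pi) Real.pi

/-- `W_i` (here `i : Fin (2p)` encodes the 1-based index `i+1 ∈ {1,…,2p}`):
for `i+1 < 2p`, `W_{i+1} = {x : |x̄_{i+1}| ≤ c |x_{i+2}|}`;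
the last one is `W_{2p} = {x : |x̄_{2p}| ≤ c |x̄_{2p} - x_1|}`. -/
def Wset (p : ℕ) (c : ℝ) (i : Fin (2 * p)) : Set (Fin (2 * p) → ℝ) :=
  if (i : ℕ) + 1 < 2 * p then {x | |psum x ((i : ℕ) + 1)| ≤ c * |xval x ((i : ℕ) + 1)|}
  else {x | |psum x (2 * p)| ≤ c * |psum x (2 * p) - psum x 1|}

/-- `W = ∪_{j=1}^{2p} W_j`. -/
def W (p : ℕ) (c : ℝ) : Set (Fin (2 * p) → ℝ) := ⋃ i, Wset p c i

/-- `k_j^{(π_j)}(x̄_{2j-1})`: equals `g_j(x̄_{2j-1}) h_j(x̄_{2j-1})` when `π_j = 0`, and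
`g_j(x̄_{2j-1}) (h_j(x̄_{2j-1} + x_{2j}) - h_j(x̄_{2j-1}))` when `π_j = 1`. -/
def kfun {p : ℕ} (g h : Fin p → ℝ → ℝ) (sgn : Fin p → Fin 2) (x : Fin (2 * p) → ℝ)
    (j : Fin p) : ℝ :=
  if sgn j = 0 then g j (psum x (2 * (j : ℕ) + 1)) * h j (psum x (2 * (j : ℕ) + 1))
  else
    g j (psum x (2 * (j : ℕ) + 1)) *
      (h j (psum x (2 * (j : ℕ) + 1) + xval x (2 * (j : ℕ) + 1)) -
        h j (psum x (2 * (j : ℕ) + 1)))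

/-- `conj(D_n(x̄_{2p} - x_1)) ∏_{j=2}^{2p} D_n(x_j)`. -/
def Dprod (p n : ℕ) (x : Fin (2 * p) → ℝ) : ℂ :=
  (starRingEnd ℂ) (Dn n (psum x (2 * p) - psum x 1)) *
    ∏ j ∈ Finset.univ.filter fun j : Fin (2 * p) => 1 ≤ (j : ℕ), Dn n (x j)

/-- `I_{n,1}^π`. -/
def I1 {p : ℕ} (g h : Fin p → ℝ → ℝ) (sgn : Fin p → Fin 2) (c : ℝ) (n : ℕ) : ℂ :=
  ∫ x in PiBox (2 * p) ∩ W p c, (↑(∏ j, kfun g h sgn x j) : ℂ) * Dprod p n x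

/-- `I_{n,2}^π`. -/
def I2 {p : ℕ} (g h : Fin p → ℝ → ℝ) (sgn : Fin p → Fin 2) (c : ℝ) (n : ℕ) : ℂ :=
  ∫ x in PiBox (2 * p) ∩ (W p c)ᶜ, (↑(∏ j, kfun g h sgn x j) : ℂ) * Dprod p n x

/-- `I_n`. -/
def Ifull {p : ℕ} (g h : Fin p → ℝ → ℝ) (n : ℕ) : ℂ :=
  ∫ x in PiBox (2 * p),
    (↑(∏ j : Fin p, g j (psum x (2 * (j : ℕ) + 1)) * h j (psum x (2 * (j : ℕ) + 1))) : ℂ) *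
      Dprod p n x

theorem Ln_upper (n : ℕ) (hn : 2 ≤ n) (x : ℝ) : Ln n x ≤ 2 * (|x| + (n : ℝ)⁻¹)⁻¹ := by
  have hn0 : (0 : ℝ) < n := by positivity
  have ha : (0 : ℝ) < (n : ℝ)⁻¹ := by positivity
  unfold Ln
  split_ifs with h
  · subst h
    simp
    linarith
  · have hx : 0 < |x| := abs_pos.mpr h
    rw [← div_eq_mul_inv, le_div_iff₀ (by positivity)]
    have h1 : min |x|⁻¹ (n : ℝ) * |x| ≤ 1 := by
      calc min |x|⁻¹ (n : ℝ) * |x| ≤ |x|⁻¹ * |x| := by gcongr; exact min_le_left _ _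
        _ = 1 := by field_simp
    have h2 : min |x|⁻¹ (n : ℝ) * (n : ℝ)⁻¹ ≤ 1 := by
      calc min |x|⁻¹ (n : ℝ) * (n : ℝ)⁻¹ ≤ n * (n : ℝ)⁻¹ := by gcongr; exact min_le_right _ _
        _ = 1 := by field_simp
    linarith

theorem Ln_lower (n : ℕ) (hn : 2 ≤ n) (x : ℝ) : (|x| + (n : ℝ)⁻¹)⁻¹ ≤ Ln n x := by
  have hn0 : (0 : ℝ) < n := by positivity
  have ha : (0 : ℝ) < (n : ℝ)⁻¹ := by positivity
  unfold Ln
  split_ifs with h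
  · subst h
    simp
  · have hx : 0 < |x| := abs_pos.mpr h
    refine le_min ?_ ?_
    · exact inv_anti₀ hx (by linarith)
    · calc (|x| + (n : ℝ)⁻¹)⁻¹ ≤ ((n : ℝ)⁻¹)⁻¹ := inv_anti₀ ha (by linarith)
        _ = n := inv_inv _

theorem Ln_nonneg (n : ℕ) (x : ℝ) : 0 ≤ Ln n x := by
  unfold Ln
  split_ifs <;> positivity

theorem K_cont (a : ℝ) (ha : 0 < a) : Continuous fun z : ℝ => (|z| + a)⁻¹ := by
  refine Continuous.inv₀ (by fun_prop) fun z => ?_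
  have := abs_nonneg z
  positivity

theorem K_int (a R : ℝ) (ha : 0 < a) (hR : 0 < R) :
    ∫ z in (-R)..R, (|z| + a)⁻¹ = 2 * Real.log ((R + a) / a) := by
  have hc := K_cont a ha
  have h1 : ∫ z in (0 : ℝ)..R, (|z| + a)⁻¹ = Real.log ((R + a) / a) := by
    have : ∫ z in (0 : ℝ)..R, (|z| + a)⁻¹ = ∫ z in (0 : ℝ)..R, (z + a)⁻¹ := by
      refine intervalIntegral.integral_congr fun z hz => ?_
      rw [Set.uIcc_of_le hR.le] at hz
      simp only [abs_of_nonneg hz.1]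
    rw [this, intervalIntegral.integral_comp_add_right (fun z => z⁻¹) a,
      integral_inv_of_pos (by linarith) (by linarith), zero_add]
  have h2 : ∫ z in (-R)..(0 : ℝ), (|z| + a)⁻¹ = Real.log ((R + a) / a) := by
    rw [← h1]
    have := intervalIntegral.integral_comp_neg (a := 0) (b := R) (fun z : ℝ => (|z| + a)⁻¹)
    simp only [abs_neg, neg_zero] at this
    exact this.symm
  rw [← intervalIntegral.integral_add_adjacent_intervals (hc.intervalIntegrable (-R) 0)
    (hc.intervalIntegrable 0 R), h1, h2]
  ring

theorem K_shift (n : ℕ) (hn : 2 ≤ n) (x : ℝ) (hx : x ∈ Set.Icc (-Real.pi) Real.pi) :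
    ∫ y in (-Real.pi)..Real.pi, (|x - y| + (n : ℝ)⁻¹)⁻¹ ≤ 8 * Real.log n := by
  have hn2 : (2 : ℝ) ≤ n := by exact_mod_cast hn
  have ha : (0 : ℝ) < (n : ℝ)⁻¹ := by positivity
  have hp := Real.pi_pos
  have hp' := Real.pi_lt_d2
  have hc := K_cont _ ha
  rw [intervalIntegral.integral_comp_sub_left (fun z : ℝ => (|z| + (n : ℝ)⁻¹)⁻¹) x]
  have h1 : ∫ z in (x - Real.pi)..(x - -Real.pi), (|z| + (n : ℝ)⁻¹)⁻¹
      ≤ ∫ z in (-(2 * Real.pi))..(2 * Real.pi), (|z| + (n : ℝ)⁻¹)⁻¹ := by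
    refine intervalIntegral.integral_mono_interval (by linarith [hx.1]) (by linarith)
      (by linarith [hx.2]) ?_ (hc.intervalIntegrable _ _)
    exact Filter.Eventually.of_forall fun z => by positivity
  rw [K_int _ _ ha (by positivity)] at h1
  have h2 : Real.log ((2 * Real.pi + (n : ℝ)⁻¹) / (n : ℝ)⁻¹) ≤ 4 * Real.log n := by
    have : (4 : ℝ) * Real.log n = Real.log ((n : ℝ) ^ 4) := by
      rw [Real.log_pow]; norm_num
    rw [this]
    refine Real.log_le_log (by positivity) ?_
    have e : (2 * Real.pi + (n : ℝ)⁻¹) / (n : ℝ)⁻¹ = 2 * Real.pi * n + 1 := by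
      field_simp
    rw [e]
    have h3 : (2 : ℝ) ^ 3 ≤ (n : ℝ) ^ 3 := by gcongr
    nlinarith
  linarith

/-- `∫_Π L_n(x-y) L_n(y) dy ≤ C L_n(x) log n`. -/
theorem stmt5 :
    ∃ C : ℝ, 0 < C ∧ ∀ n : ℕ, 2 ≤ n → ∀ x ∈ Set.Icc (-Real.pi) Real.pi,
      (∫ y in Set.Icc (-Real.pi) Real.pi, Ln n (x - y) * Ln n y)
        ≤ C * Ln n x * Real.log n := by
  refine ⟨64, by norm_num, fun n hn x hx => ?_⟩
  have hn2 : (2 : ℝ) ≤ n := by exact_mod_cast hn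
  have ha : (0 : ℝ) < (n : ℝ)⁻¹ := by positivity
  have hp := Real.pi_pos
  have hlog : 0 ≤ Real.log n := Real.log_nonneg (by linarith)
  have hc := K_cont _ ha
  have hc1 : Continuous fun y : ℝ => (|x - y| + (n : ℝ)⁻¹)⁻¹ :=
    hc.comp (continuous_const.sub continuous_id)
  have hc0 : Continuous fun y : ℝ => (|0 - y| + (n : ℝ)⁻¹)⁻¹ :=
    hc.comp (continuous_const.sub continuous_id)
  have hK1 := K_shift n hn x hx
  have hK0 := K_shift n hn 0 ⟨by linarith, by linarith⟩
  have hmono : (∫ y in Set.Icc (-Real.pi) Real.pi, Ln n (x - y) * Ln n y) ≤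
      ∫ y in Set.Icc (-Real.pi) Real.pi, 4 * (|x| + (n : ℝ)⁻¹)⁻¹ *
        ((|x - y| + (n : ℝ)⁻¹)⁻¹ + (|0 - y| + (n : ℝ)⁻¹)⁻¹) := by
    refine integral_mono_of_nonneg
      (Filter.Eventually.of_forall fun y => mul_nonneg (Ln_nonneg _ _) (Ln_nonneg _ _)) ?_
      (Filter.Eventually.of_forall fun y => ?_)
    · exact (continuous_const.mul (hc1.add hc0)).continuousOn.integrableOn_compact isCompact_Icc
    · have hu := Ln_upper n hn (x - y)
      have hv := Ln_upper n hn y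
      have hmul := mul_le_mul hu hv (Ln_nonneg _ _) (by positivity)
      refine hmul.trans ?_
      simp only [zero_sub, abs_neg]
      have htri : |x| ≤ |x - y| + |y| := by
        simpa using abs_add_le (x - y) y
      have h1 := abs_nonneg (x - y)
      have h2 := abs_nonneg y
      have h3 := abs_nonneg x
      set u := |x - y| + (n : ℝ)⁻¹ with hu'
      set v := |y| + (n : ℝ)⁻¹ with hv'
      set w := |x| + (n : ℝ)⁻¹ with hw'
      have hu0 : 0 < u := by linarith
      have hv0 : 0 < v := by linarith
      have hw0 : 0 < w := by linarith
      have hle : w ≤ u + v := by linarith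
      have e1 : 2 * u⁻¹ * (2 * v⁻¹) = 4 * w⁻¹ * (u⁻¹ * v⁻¹) * w := by
        field_simp; norm_num
      have e2 : 4 * w⁻¹ * (u⁻¹ + v⁻¹) = 4 * w⁻¹ * (u⁻¹ * v⁻¹) * (u + v) := by
        field_simp; ring
      rw [e1, e2]
      gcongr
  refine hmono.trans ?_
  rw [integral_Icc_eq_integral_Ioc, ← intervalIntegral.integral_of_le (by linarith),
    intervalIntegral.integral_const_mul,
    intervalIntegral.integral_add (hc1.intervalIntegrable _ _) (hc0.intervalIntegrable _ _)]
  calc _ ≤ 4 * (|x| + (n : ℝ)⁻¹)⁻¹ * (8 * Real.log n + 8 * Real.log n) := by gcongr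
    _ = 64 * (|x| + (n : ℝ)⁻¹)⁻¹ * Real.log n := by ring
    _ ≤ 64 * Ln n x * Real.log n := by
      have := Ln_lower n hn x
      gcongr
end
end

section
/- Let p ∈ ℕ, α_j, β_j < 1, and let g_j ∈ F_{α_j}, h_j ∈ F_{β_j} (j = 1,…,p) be real-valued functions each extending to a 2π-periodic function on ℝ. Then for every n ∈ ℕ, Tr[∏_{j=1}^p T_n(g_j) T_n(h_j)] = ∫_{Π^{2p}} (∏_{j=1}^p g_j(x̄_{2j−1}) h_j(x̄_{2j})) · conj(D_n(x̄_{2p} − x_1)) · ∏_{j=2}^{2p} D_n(x_j) dx_1 ⋯ dx_{2p}, where x̄_j := x_1 + ⋯ + x_j. -/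
open MeasureTheory Real Filter Asymptotics Set Finset Topology

noncomputable section

instance fact_two_pi_pos : Fact (0 < 2 * Real.pi) := ⟨by positivity⟩

/-- section of the quotient map to the circle -/
def sec (u : AddCircle (2 * Real.pi)) : ℝ := (AddCircle.equivIoc (2 * Real.pi) (-Real.pi) u : ℝ)

lemma coe_sec (u : AddCircle (2 * Real.pi)) : ((sec u : ℝ) : AddCircle (2 * Real.pi)) = u := by
  exact (AddCircle.equivIoc (2 * Real.pi) (-Real.pi)).symm_apply_apply u

lemma sec_mp : MeasurePreserving sec volume
    (volume.restrict (Set.Icc (-Real.pi) Real.pi)) := by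
  have h := (measurePreserving_subtype_coe (μa := (volume : Measure ℝ))
    (s := Set.Ioc (-Real.pi) (-Real.pi + 2 * Real.pi)) measurableSet_Ioc).comp
    (AddCircle.measurePreserving_equivIoc (2 * Real.pi) (a := -Real.pi))
  have e : -Real.pi + 2 * Real.pi = Real.pi := by ring
  have e2 : (volume : Measure ℝ).restrict (Set.Ioc (-Real.pi) (-Real.pi + 2 * Real.pi))
      = volume.restrict (Set.Icc (-Real.pi) Real.pi) := by
    rw [e]; exact Measure.restrict_congr_set Ioc_ae_eq_Icc
  rw [e2] at h
  exact h

lemma restrict_box (m : ℕ) : (volume : Measure (Fin m → ℝ)).restrict (PiBox m)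
    = Measure.pi (fun _ => volume.restrict (Set.Icc (-Real.pi) Real.pi)) := by
  unfold PiBox
  rw [volume_pi, Measure.restrict_pi_pi]

lemma integral_box {m : ℕ} (H : (Fin m → ℝ) → ℂ) :
    ∫ x in PiBox m, H x = ∫ u : Fin m → AddCircle (2 * Real.pi), H (fun i => sec (u i)) := by
  rw [restrict_box]
  have hmp : MeasurePreserving (fun (u : Fin m → AddCircle (2 * Real.pi)) i => sec (u i)) volume
      (Measure.pi (fun _ => volume.restrict (Set.Icc (-Real.pi) Real.pi))) :=
    measurePreserving_pi _ _ (fun _ => sec_mp)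
  have hemb : MeasurableEmbedding (fun (u : Fin m → AddCircle (2 * Real.pi)) i => sec (u i)) := by
    refine hmp.measurable.measurableEmbedding ?_
    intro u v huv
    funext i
    rw [← coe_sec (u i), ← coe_sec (v i)]
    exact congrArg _ (congrFun huv i)
  exact (hmp.integral_comp hemb H).symm

/-- partial sum map in any group -/
def gsum {G : Type*} [AddCommGroup G] {m : ℕ} (x : Fin m → G) (j : ℕ) : G :=
  ∑ k ∈ Finset.range j, if h : k < m then x ⟨k, h⟩ else 0

/-- the shear -/
def shear (G : Type*) [AddCommGroup G] (m : ℕ) : (Fin m → G) →+ (Fin m → G) where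
  toFun x i := gsum x (i + 1)
  map_zero' := by funext i; simp [gsum]
  map_add' x y := by
    funext i
    simp only [gsum, Pi.add_apply, ← Finset.sum_add_distrib]
    refine Finset.sum_congr rfl fun k _ => ?_
    split_ifs <;> simp

lemma shear_inj (G : Type*) [AddCommGroup G] (m : ℕ) : Function.Injective (shear G m) := by
  intro x y hxy
  have h1 : ∀ j, j ≤ m → gsum x j = gsum y j := by
    intro j hj
    cases j with
    | zero => simp [gsum]
    | succ j => exact congrFun hxy ⟨j, hj⟩
  funext i
  have a := h1 (i + 1) i.2
  have b := h1 i i.2.le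
  unfold gsum at a b
  rw [Finset.sum_range_succ, Finset.sum_range_succ, b] at a
  simpa using a

lemma shear_surj (G : Type*) [AddCommGroup G] (m : ℕ) : Function.Surjective (shear G m) := by
  intro w
  refine ⟨fun i => w i - if h : 0 < (i : ℕ) then w ⟨i - 1, by omega⟩ else 0, ?_⟩
  have key : ∀ j (hj : j < m), gsum (fun i : Fin m => w i - if h : 0 < (i : ℕ) then
      w ⟨i - 1, by omega⟩ else 0) (j + 1) = w ⟨j, hj⟩ := by
    intro j
    induction j with
    | zero => intro hj; simp [gsum, hj]
    | succ j ih =>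
      intro hj
      have := ih (by omega)
      unfold gsum at this ⊢
      rw [Finset.sum_range_succ, this]
      simp [hj]
  funext i
  exact key i i.2

lemma shear_cont (m : ℕ) : Continuous (shear (AddCircle (2 * Real.pi)) m) := by
  refine continuous_pi fun i => ?_
  change Continuous fun x => gsum x (i + 1)
  unfold gsum
  refine continuous_finsetSum _ fun k _ => ?_
  split_ifs
  · exact continuous_apply _
  · exact continuous_const

lemma integral_shear {m : ℕ} (H : (Fin m → ℝ) → ℂ)
    (hH : ∀ y y' : Fin m → ℝ, (∀ i, (y i : AddCircle (2 * Real.pi)) = y' i) → H y = H y') :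
    ∫ x in PiBox m, H (fun i => psum x (i + 1)) = ∫ y in PiBox m, H y := by
  rw [integral_box, integral_box]
  have hmp : MeasurePreserving (shear (AddCircle (2 * Real.pi)) m) volume volume :=
    (shear (AddCircle (2 * Real.pi)) m).measurePreserving (shear_cont m) (shear_surj _ m) rfl
  have hemb : MeasurableEmbedding (shear (AddCircle (2 * Real.pi)) m) :=
    hmp.measurable.measurableEmbedding (shear_inj _ m)
  rw [← hmp.integral_comp hemb (fun u => H (fun i => sec (u i)))]
  congr 1
  funext u
  apply hH
  intro i
  rw [coe_sec]
  change ((∑ k ∈ Finset.range _, _ : ℝ) : AddCircle (2 * Real.pi)) =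
    ∑ k ∈ Finset.range _, _
  rw [← QuotientAddGroup.mk'_apply, map_sum]
  refine Finset.sum_congr rfl fun k _ => ?_
  split_ifs
  · exact coe_sec _
  · exact map_zero _

lemma prod_ofFn_apply {n : ℕ} (m : ℕ) : ∀ (A : Fin (m + 1) → Matrix (Fin n) (Fin n) ℂ)
    (i j : Fin n), (List.ofFn A).prod i j =
      ∑ t : Fin m → Fin n, ∏ k : Fin (m + 1),
        A k ((Fin.cons i t : Fin (m + 1) → Fin n) k) ((Fin.snoc t j : Fin (m + 1) → Fin n) k) := by
  induction m with
  | zero => intro A i j; simp [Fin.snoc]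
  | succ m ih =>
    intro A i j
    rw [List.ofFn_succ, List.prod_cons, Matrix.mul_apply]
    rw [← (Fin.consEquiv (fun _ : Fin (m + 1) => Fin n)).sum_comp, Fintype.sum_prod_type]
    refine Finset.sum_congr rfl fun a _ => ?_
    rw [ih, Finset.mul_sum]
    refine Finset.sum_congr rfl fun t _ => ?_
    rw [Fin.prod_univ_succ (n := m + 1)]
    simp only [Fin.consEquiv, Equiv.coe_fn_mk, Fin.cons_zero, Fin.cons_succ]
    rw [← Fin.cons_snoc_eq_snoc_cons]
    simp only [Fin.cons_zero, Fin.cons_succ]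

lemma trace_prod {n m : ℕ} (A : Fin (m + 1) → Matrix (Fin n) (Fin n) ℂ) :
    Matrix.trace (List.ofFn A).prod =
      ∑ t : Fin (m + 1) → Fin n, ∏ k : Fin (m + 1), A k (t k) (t (k + 1)) := by
  rw [Matrix.trace, ← (Fin.consEquiv (fun _ : Fin (m + 1) => Fin n)).sum_comp,
    Fintype.sum_prod_type]
  refine Finset.sum_congr rfl fun i _ => ?_
  rw [Matrix.diag_apply, prod_ofFn_apply]
  refine Finset.sum_congr rfl fun t _ => Finset.prod_congr rfl fun k _ => ?_
  simp only [Fin.consEquiv, Equiv.coe_fn_mk]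
  congr 1
  induction k using Fin.lastCases with
  | last => simp
  | cast k => simp

lemma Dn_neg (n : ℕ) (x : ℝ) : Dn n (-x) = (starRingEnd ℂ) (Dn n x) := by
  unfold Dn
  rw [map_sum]
  refine Finset.sum_congr rfl fun t _ => ?_
  rw [← Complex.exp_conj]
  congr 1
  simp

lemma Dn_periodic (n : ℕ) : Function.Periodic (Dn n) (2 * Real.pi) := by
  intro x
  unfold Dn
  refine Finset.sum_congr rfl fun t _ => ?_
  rw [Complex.exp_eq_exp_iff_exists_int]
  refine ⟨t + 1, ?_⟩
  push_cast
  ring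

lemma periodic_congr {E : Type*} {f : ℝ → E} (hf : Function.Periodic f (2 * Real.pi)) {y y' : ℝ}
    (h : (y : AddCircle (2 * Real.pi)) = y') : f y = f y' := by
  have := congrArg hf.lift h
  simpa using this

lemma toep_exp_sum {n m : ℕ} (y : Fin (m + 1) → ℝ) :
    ∑ t : Fin (m + 1) → Fin n, ∏ k : Fin (m + 1),
      Complex.exp (Complex.I * ((((t k : ℕ) : ℤ) - ((t (k + 1) : ℕ) : ℤ) : ℤ) : ℂ) * (y k : ℂ))
    = ∏ k, Dn n (y k - y (k - 1)) := by
  have h1 : ∀ k, Dn n (y k - y (k - 1)) = ∑ s : Fin n,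
      Complex.exp (Complex.I * (((s : ℕ) : ℂ) + 1) * ((y k - y (k - 1) : ℝ) : ℂ)) := by
    intro k
    unfold Dn
    rw [Finset.sum_range]
  simp only [h1]
  rw [Fintype.prod_sum]
  refine Finset.sum_congr rfl fun t _ => ?_
  have h2 : ∏ k, Complex.exp (Complex.I * (((t k : ℕ) : ℂ) + 1) * ((y k - y (k - 1) : ℝ) : ℂ))
      = (∏ k, Complex.exp (Complex.I * (((t k : ℕ) : ℂ) + 1) * (y k : ℂ))) *
        ∏ k, Complex.exp (-(Complex.I * (((t k : ℕ) : ℂ) + 1) * (y (k - 1) : ℂ))) := by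
    rw [← Finset.prod_mul_distrib]
    refine Finset.prod_congr rfl fun k _ => ?_
    rw [← Complex.exp_add]; congr 1; push_cast; ring
  rw [h2, ← Equiv.prod_comp (Equiv.addRight (1 : Fin (m + 1))) (fun k =>
    Complex.exp (-(Complex.I * (((t k : ℕ) : ℂ) + 1) * (y (k - 1) : ℂ)))),
    ← Finset.prod_mul_distrib]
  refine Finset.prod_congr rfl fun k _ => ?_
  rw [← Complex.exp_add]; congr 1
  simp only [Equiv.coe_addRight, add_sub_cancel_right]
  push_cast; ring

lemma integrable_term {f : ℝ → ℝ} (hf : IntegrableOn f (Set.Icc (-Real.pi) Real.pi)) (τ : ℤ) :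
    Integrable (fun x : ℝ => Complex.exp (Complex.I * (τ : ℂ) * (x : ℂ)) * (f x : ℂ))
      (volume.restrict (Set.Icc (-Real.pi) Real.pi)) := by
  refine Integrable.bdd_mul (c := 1) hf.ofReal (by fun_prop) (ae_of_all _ fun x => ?_)
  rw [Complex.norm_exp]
  simp

lemma trace_eq {n m : ℕ} (f : Fin (m + 1) → ℝ → ℝ)
    (hf : ∀ k, IntegrableOn (f k) (Set.Icc (-Real.pi) Real.pi)) :
    Matrix.trace (List.ofFn fun k => Toep n (f k)).prod =
      ∫ y in PiBox (m + 1), (∏ k, (f k (y k) : ℂ)) * ∏ k, Dn n (y k - y (k - 1)) := by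
  rw [trace_prod, restrict_box]
  simp only [← toep_exp_sum, Finset.mul_sum, Toep, Matrix.of_apply, fourierCoef]
  rw [integral_finsetSum]
  · refine Finset.sum_congr rfl fun t _ => ?_
    rw [← integral_fintype_prod_eq_prod (𝕜 := ℂ)]
    congr 1
    funext y
    rw [Finset.prod_mul_distrib, mul_comm]
  · intro t _
    simp only [← Finset.prod_mul_distrib]
    refine Integrable.fintype_prod (f := fun k (x : ℝ) => (f k x : ℂ) * Complex.exp (Complex.I *
      ((((t k : ℕ) : ℤ) - ((t (k + 1) : ℕ) : ℤ) : ℤ) : ℂ) * (x : ℂ))) fun k => ?_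
    simp only [mul_comm (f k _ : ℂ)]
    exact integrable_term (hf k) _

lemma psum_succ {m : ℕ} (x : Fin m → ℝ) (k : Fin m) :
    psum x (k + 1) - psum x k = x k := by
  unfold psum
  rw [Finset.sum_range_succ]
  simp

lemma trace_main {n M : ℕ} (hM : 0 < M) (f : ℕ → ℝ → ℝ)
    (hf : ∀ k, k < M → IntegrableOn (f k) (Set.Icc (-Real.pi) Real.pi))
    (hper : ∀ k, k < M → Function.Periodic (f k) (2 * Real.pi)) :
    Matrix.trace (List.ofFn fun k : Fin M => Toep n (f k)).prod =
      ∫ x in PiBox M, (∏ k : Fin M, (f k (psum x (k + 1)) : ℂ)) *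
        ((starRingEnd ℂ) (Dn n (psum x M - psum x 1)) *
          ∏ j ∈ Finset.univ.filter fun j : Fin M => 1 ≤ (j : ℕ), Dn n (x j)) := by
  obtain ⟨m, rfl⟩ : ∃ m, M = m + 1 := ⟨M - 1, by omega⟩
  rw [trace_eq (fun k : Fin (m + 1) => f k) (fun k => hf k k.2), ← integral_shear]
  · congr 1
    funext x
    congr 1
    have hfil : (∏ j ∈ Finset.univ.filter fun j : Fin (m + 1) => 1 ≤ (j : ℕ), Dn n (x j))
        = ∏ i : Fin m, Dn n (x i.succ) := by
      rw [Finset.prod_filter, Fin.prod_univ_succ]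
      simp
    rw [Fin.prod_univ_succ, hfil]
    have h0 : (0 : Fin (m + 1)) - 1 = Fin.last m := by
      rw [sub_eq_iff_eq_add]; simp
    have hs : ∀ i : Fin m, i.succ - 1 = i.castSucc := by
      intro i
      rw [sub_eq_iff_eq_add]; simp
    rw [h0, ← Dn_neg, neg_sub]
    simp only [hs]
    simp only [Fin.val_zero, Fin.val_last, Fin.val_succ, Fin.val_castSucc, zero_add]
    congr 1
    refine Finset.prod_congr rfl fun i _ => ?_
    rw [← psum_succ x i.succ]
    simp
  · intro y y' h
    congr 1
    · refine Finset.prod_congr rfl fun k _ => ?_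
      rw [periodic_congr (hper k k.2) (h k)]
    · refine Finset.prod_congr rfl fun k _ => ?_
      refine periodic_congr (Dn_periodic n) ?_
      rw [AddCircle.coe_sub, AddCircle.coe_sub, h, h]

lemma list_pair {R : Type*} [Monoid R] (B : ℕ → R) (p : ℕ) :
    (List.ofFn fun k : Fin (2 * p) => B k).prod =
      (List.ofFn fun j : Fin p => B (2 * j) * B (2 * j + 1)).prod := by
  induction p with
  | zero => simp
  | succ p ih =>
    rw [List.ofFn_succ_last (n := p)]
    change (List.ofFn fun k : Fin (2 * p + 1 + 1) => B k).prod = _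
    rw [List.ofFn_succ_last, List.ofFn_succ_last]
    simp only [Fin.val_castSucc, Fin.val_last, List.prod_append, List.prod_singleton, ih, mul_assoc]

lemma prod_pair {R : Type*} [CommMonoid R] (B : ℕ → R) (p : ℕ) :
    ∏ k : Fin (2 * p), B k = ∏ j : Fin p, (B (2 * j) * B (2 * j + 1)) := by
  rw [← List.prod_ofFn, ← List.prod_ofFn, list_pair]

/-- second equality of Lemma 2: trace of `∏_j T_n(g_j) T_n(h_j)` as an
integral over `Π^{2p}` in the variables `x_j`, with `x̄_j = x_1 + ⋯ + x_j = psum x j`. -/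
theorem stmt7 (p : ℕ) (hp : 0 < p) (α β : Fin p → ℝ)
    (hα : ∀ j, α j < 1) (hβ : ∀ j, β j < 1)
    (g h : Fin p → ℝ → ℝ)
    (hg : ∀ j, MemF (α j) (g j)) (hh : ∀ j, MemF (β j) (h j))
    (hgper : ∀ j, Function.Periodic (g j) (2 * Real.pi))
    (hhper : ∀ j, Function.Periodic (h j) (2 * Real.pi)) (n : ℕ) :
    Matrix.trace ((List.ofFn fun j : Fin p => Toep n (g j) * Toep n (h j)).prod)
      = ∫ x in PiBox (2 * p),
          (↑(∏ j : Fin p,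
              g j (psum x (2 * (j : ℕ) + 1)) * h j (psum x (2 * (j : ℕ) + 2))) : ℂ) *
            ((starRingEnd ℂ) (Dn n (psum x (2 * p) - psum x 1)) *
              ∏ j ∈ Finset.univ.filter fun j : Fin (2 * p) => 1 ≤ (j : ℕ), Dn n (x j)) := by
  let f : ℕ → ℝ → ℝ := fun k => if hk : k / 2 < p then
    (if k % 2 = 0 then g ⟨k / 2, hk⟩ else h ⟨k / 2, hk⟩) else 0
  have hf0 : ∀ j : Fin p, f (2 * j) = g j := by
    intro j
    have e : 2 * (j : ℕ) / 2 = j := by omega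
    simp [f]
  have hf1 : ∀ j : Fin p, f (2 * j + 1) = h j := by
    intro j
    have e : (2 * (j : ℕ) + 1) / 2 = j := by omega
    have e2 : (2 * (j : ℕ) + 1) % 2 = 1 := by omega
    simp [f, e, e2]
  have hcases : ∀ k, k < 2 * p → (∃ j, f k = g j) ∨ ∃ j, f k = h j := by
    intro k hk
    have hk2 : k / 2 < p := by omega
    rcases Nat.mod_two_eq_zero_or_one k with e | e
    · left; exact ⟨⟨k / 2, hk2⟩, by simp [f, hk2, e]⟩
    · right; exact ⟨⟨k / 2, hk2⟩, by simp [f, hk2, e]⟩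
  have hI : ∀ k, k < 2 * p → IntegrableOn (f k) (Set.Icc (-Real.pi) Real.pi) := by
    intro k hk
    rcases hcases k hk with ⟨j, e⟩ | ⟨j, e⟩
    · rw [e]; exact (hg j).1
    · rw [e]; exact (hh j).1
  have hP : ∀ k, k < 2 * p → Function.Periodic (f k) (2 * Real.pi) := by
    intro k hk
    rcases hcases k hk with ⟨j, e⟩ | ⟨j, e⟩
    · rw [e]; exact hgper j
    · rw [e]; exact hhper j
  have main := trace_main (n := n) (M := 2 * p) (by omega) f hI hP
  rw [list_pair (fun k => Toep n (f k))] at main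
  simp only [hf0, hf1] at main
  rw [main]
  congr 1
  funext x
  congr 1
  rw [prod_pair (fun k => (f k (psum x (k + 1)) : ℂ))]
  simp only [hf0, hf1]
  push_cast
  rfl
end
end

section
/- Let p ∈ ℕ, α_j, β_j < 1, M > 0, and let g_j, h_j : ℝ → ℝ satisfy |g_j(x)| ≤ M|x|^{−α_j} for x ≠ 0, h_j differentiable on ℝ∖{0} with |h_j(x)| ≤ M|x|^{−β_j} and |h_j′(x)| ≤ M|x|^{−β_j−1} for x ≠ 0. Fix c > 1 and let π ∈ {0,1}^p. Then there is a constant C (depending on p, c, M and the exponents) such that for every x = (x_1,…,x_{2p}) ∈ Π^{2p} ∩ W^c with x_1 ≠ 0, |∏_{j=1}^p k_j^{(π_j)}(x̄_{2j−1})| ≤ C |x_1|^{−∑_{j=1}^p(α_j+β_j) − |π|} ∏_{j=1}^p |x_{2j}|^{π_j}, where |π| := ∑_{j=1}^p π_j. -/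
open MeasureTheory Real Filter Asymptotics Set Finset Topology

noncomputable section

lemma aux_rpow {L U y t : ℝ} (hL : 0 < L) (hU : 0 < U) (hy : 0 < y) (h1 : L * y ≤ t) (h2 : t ≤ U * y)
    (s : ℝ) : t ^ s ≤ (L ^ s + U ^ s) * y ^ s := by
  have ht : 0 < t := lt_of_lt_of_le (by positivity) h1
  have hLs : 0 < L ^ s := Real.rpow_pos_of_pos hL s
  have hUs : 0 < U ^ s := Real.rpow_pos_of_pos hU s
  have hys : 0 < y ^ s := Real.rpow_pos_of_pos hy s
  rcases le_total 0 s with hs | hs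
  · have := Real.rpow_le_rpow ht.le h2 hs
    rw [Real.mul_rpow hU.le hy.le] at this
    nlinarith [mul_pos hLs hys]
  · have := Real.rpow_le_rpow_of_nonpos (by positivity : 0 < L * y) h1 hs
    rw [Real.mul_rpow hL.le hy.le] at this
    nlinarith [mul_pos hUs hys]

lemma aux_step {p : ℕ} {c : ℝ} {x : Fin (2 * p) → ℝ} (hc : 1 < c) (hx : x ∈ (W p c)ᶜ) {n : ℕ}
    (hn : n + 1 < 2 * p) : |xval x (n + 1)| ≤ c⁻¹ * |psum x (n + 1)| := by
  have h1 : x ∉ Wset p c ⟨n, by omega⟩ := fun hh => hx (Set.mem_iUnion.2 ⟨_, hh⟩)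
  simp only [Wset, hn, if_true, Set.mem_setOf_eq, not_le] at h1
  have hc0 : 0 < c := by linarith
  rw [inv_mul_eq_div, le_div_iff₀ hc0]
  linarith

lemma aux_psum {p : ℕ} {c : ℝ} {x : Fin (2 * p) → ℝ} (hc : 1 < c) (hx : x ∈ (W p c)ᶜ) (n : ℕ)
    (hn : n + 1 ≤ 2 * p) : (1 - c⁻¹) ^ n * |xval x 0| ≤ |psum x (n + 1)| ∧
      |psum x (n + 1)| ≤ (1 + c⁻¹) ^ n * |xval x 0| := by
  have hci : 0 < c⁻¹ := inv_pos.2 (by linarith)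
  have hci1 : c⁻¹ < 1 := inv_lt_one_of_one_lt₀ hc
  induction n with
  | zero => simp [psum, xval]
  | succ n ih =>
    obtain ⟨ih1, ih2⟩ := ih (by omega)
    have hs := aux_step hc hx (n := n) (by omega)
    have he : psum x (n + 1 + 1) = psum x (n + 1) + xval x (n + 1) := by
      rw [psum, Finset.sum_range_succ]; rfl
    rw [he]
    have t1 := abs_add_le (psum x (n + 1)) (xval x (n + 1))
    have t2 := abs_sub_abs_le_abs_sub (psum x (n + 1)) (-xval x (n + 1))
    rw [abs_neg, sub_neg_eq_add] at t2
    rw [pow_succ', pow_succ', mul_assoc, mul_assoc]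
    constructor
    · have := mul_le_mul_of_nonneg_left ih1 (by linarith : 0 ≤ 1 - c⁻¹)
      linarith
    · have := mul_le_mul_of_nonneg_left ih2 (by linarith : 0 ≤ 1 + c⁻¹)
      linarith

/-- Lemma 3: pointwise bound for `∏_j k_j^{(π_j)}(x̄_{2j-1})` on
`Π^{2p} ∩ Wᶜ ∩ {x_1 ≠ 0}`. Here `x_1 = xval x 0` and `x_{2j} = xval x (2j-1)`
(zero-based indexing). -/
theorem stmt12 (p : ℕ) (hp : 0 < p) (c : ℝ) (hc : 1 < c) (α β : Fin p → ℝ)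
    (hα : ∀ j, α j < 1) (hβ : ∀ j, β j < 1) (M : ℝ) (hM : 0 < M)
    (g h : Fin p → ℝ → ℝ) (h' : Fin p → ℝ → ℝ)
    (hbg : ∀ j, ∀ x : ℝ, x ≠ 0 → |g j x| ≤ M * |x| ^ (-(α j)))
    (hbh : ∀ j, ∀ x : ℝ, x ≠ 0 → |h j x| ≤ M * |x| ^ (-(β j)))
    (hdiff : ∀ j, ∀ x : ℝ, x ≠ 0 → HasDerivAt (h j) (h' j x) x)
    (hbh' : ∀ j, ∀ x : ℝ, x ≠ 0 → |h' j x| ≤ M * |x| ^ (-(β j) - 1))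
    (sgn : Fin p → Fin 2) :
    ∃ C : ℝ, ∀ x ∈ PiBox (2 * p) ∩ (W p c)ᶜ, xval x 0 ≠ 0 →
      |∏ j : Fin p, kfun g h sgn x j|
        ≤ C * |xval x 0| ^ (-(∑ j, (α j + β j)) - ∑ j, ((sgn j : ℕ) : ℝ)) *
            ∏ j : Fin p, |xval x (2 * (j : ℕ) + 1)| ^ ((sgn j : ℕ)) := by
  have hci : 0 < c⁻¹ := inv_pos.2 (by linarith)
  have hci1 : c⁻¹ < 1 := inv_lt_one_of_one_lt₀ hc
  obtain ⟨L, hLdef⟩ : ∃ L, L = (1 - c⁻¹) ^ (2 * p) := ⟨_, rfl⟩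
  obtain ⟨U, hUdef⟩ : ∃ U, U = (1 + c⁻¹) ^ (2 * p) := ⟨_, rfl⟩
  have hL : 0 < L := by rw [hLdef]; exact pow_pos (by linarith) _
  have hU : 0 < U := by rw [hUdef]; positivity
  let K : Fin p → ℝ := fun j => M * (L ^ (-(α j)) + U ^ (-(α j))) *
    (M * (L ^ (-(β j) - ((sgn j : ℕ) : ℝ)) + U ^ (-(β j) - ((sgn j : ℕ) : ℝ))))
  refine ⟨∏ j, K j, fun x hx hx0 => ?_⟩
  obtain ⟨y, hy⟩ : ∃ y, y = |xval x 0| := ⟨_, rfl⟩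
  have hy0 : 0 < y := hy ▸ abs_pos.2 hx0
  have hW := hx.2
  -- all points near the partial sums are comparable to `x_1`
  have key : ∀ j : Fin p, ∀ z : ℝ,
      |z - psum x (2 * (j : ℕ) + 1)| ≤ |xval x (2 * (j : ℕ) + 1)| →
      L * y ≤ |z| ∧ |z| ≤ U * y := by
    intro j z hz
    have hj := j.2
    obtain ⟨b1, b2⟩ := aux_psum hc hW (2 * (j : ℕ)) (by omega)
    have hs := aux_step hc hW (n := 2 * (j : ℕ)) (by omega)
    have t1 := abs_sub_abs_le_abs_sub z (psum x (2 * (j : ℕ) + 1))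
    have t2 := abs_sub_abs_le_abs_sub (psum x (2 * (j : ℕ) + 1)) z
    rw [abs_sub_comm] at t2
    rw [← hy] at b1 b2
    have e1 : L ≤ (1 - c⁻¹) * (1 - c⁻¹) ^ (2 * (j : ℕ)) := by
      rw [hLdef, ← pow_succ']
      exact pow_le_pow_of_le_one (by linarith) (by linarith) (by omega)
    have e2 : (1 + c⁻¹) * (1 + c⁻¹) ^ (2 * (j : ℕ)) ≤ U := by
      rw [hUdef, ← pow_succ']
      exact pow_le_pow_right₀ (by linarith) (by omega)
    have f1 := mul_le_mul_of_nonneg_left b1 (by linarith : 0 ≤ 1 - c⁻¹)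
    have f2 := mul_le_mul_of_nonneg_left b2 (by linarith : 0 ≤ 1 + c⁻¹)
    have g1 := mul_le_mul_of_nonneg_right e1 hy0.le
    have g2 := mul_le_mul_of_nonneg_right e2 hy0.le
    constructor <;> linarith
  have hne : ∀ z : ℝ, L * y ≤ |z| → z ≠ 0 := by
    intro z hz
    exact abs_pos.1 (lt_of_lt_of_le (by positivity) hz)
  have hk : ∀ j : Fin p, |kfun g h sgn x j| ≤
      K j * y ^ (-(α j + β j) - ((sgn j : ℕ) : ℝ)) * |xval x (2 * (j : ℕ) + 1)| ^ ((sgn j : ℕ)) := by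
    intro j
    obtain ⟨s1, s2⟩ := key j (psum x (2 * (j : ℕ) + 1)) (by simp)
    have hs0 := hne _ s1
    have hg : |g j (psum x (2 * (j : ℕ) + 1))| ≤
        M * (L ^ (-(α j)) + U ^ (-(α j))) * y ^ (-(α j)) := by
      refine (hbg j _ hs0).trans ?_
      rw [mul_assoc]
      exact mul_le_mul_of_nonneg_left (aux_rpow hL hU hy0 s1 s2 _) hM.le
    have hexp : y ^ (-(α j + β j) - ((sgn j : ℕ) : ℝ)) =
        y ^ (-(α j)) * y ^ (-(β j) - ((sgn j : ℕ) : ℝ)) := by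
      rw [← Real.rpow_add hy0]; congr 1; ring
    have hG0 : 0 ≤ M * (L ^ (-(α j)) + U ^ (-(α j))) * y ^ (-(α j)) := (abs_nonneg _).trans hg
    suffices hh : ∀ B : ℝ, kfun g h sgn x j = g j (psum x (2 * (j : ℕ) + 1)) * B →
        |B| ≤ M * (L ^ (-(β j) - ((sgn j : ℕ) : ℝ)) + U ^ (-(β j) - ((sgn j : ℕ) : ℝ))) *
          y ^ (-(β j) - ((sgn j : ℕ) : ℝ)) * |xval x (2 * (j : ℕ) + 1)| ^ ((sgn j : ℕ)) →
        |kfun g h sgn x j| ≤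
          K j * y ^ (-(α j + β j) - ((sgn j : ℕ) : ℝ)) *
            |xval x (2 * (j : ℕ) + 1)| ^ ((sgn j : ℕ)) by
      by_cases h0 : sgn j = 0
      · refine hh (h j (psum x (2 * (j : ℕ) + 1))) (by simp [kfun, h0]) ?_
        refine (hbh j _ hs0).trans ?_
        simp only [h0, Fin.val_zero, Nat.cast_zero, sub_zero, pow_zero, mul_one]
        rw [mul_assoc]
        exact mul_le_mul_of_nonneg_left (aux_rpow hL hU hy0 s1 s2 _) hM.le
      · refine hh (h j (psum x (2 * (j : ℕ) + 1) + xval x (2 * (j : ℕ) + 1)) -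
          h j (psum x (2 * (j : ℕ) + 1))) (by simp [kfun, h0]) ?_
        have h1 : sgn j = 1 := by omega
        simp only [h1, Fin.val_one, Nat.cast_one, pow_one]
        have mv := (convex_closedBall (psum x (2 * (j : ℕ) + 1))
          |xval x (2 * (j : ℕ) + 1)|).norm_image_sub_le_of_norm_hasDerivWithin_le
          (f := h j) (f' := h' j)
          (C := M * (L ^ (-(β j) - 1) + U ^ (-(β j) - 1)) * y ^ (-(β j) - 1))
          (x := psum x (2 * (j : ℕ) + 1))
          (y := psum x (2 * (j : ℕ) + 1) + xval x (2 * (j : ℕ) + 1))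
          (fun z hz => by
            rw [Metric.mem_closedBall, Real.dist_eq] at hz
            exact (hdiff j z (hne z (key j z hz).1)).hasDerivWithinAt)
          (fun z hz => by
            rw [Metric.mem_closedBall, Real.dist_eq] at hz
            obtain ⟨z1, z2⟩ := key j z hz
            rw [Real.norm_eq_abs]
            refine (hbh' j z (hne z z1)).trans ?_
            rw [mul_assoc]
            exact mul_le_mul_of_nonneg_left (aux_rpow hL hU hy0 z1 z2 _) hM.le)
          (Metric.mem_closedBall_self (abs_nonneg _))
          (by simp [Metric.mem_closedBall, Real.dist_eq])
        simpa [Real.norm_eq_abs] using mv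
    intro B hB hBb
    rw [hB, abs_mul, hexp]
    refine (mul_le_mul hg hBb (abs_nonneg _) hG0).trans (le_of_eq ?_)
    simp only [K]; ring
  rw [Finset.abs_prod, ← hy]
  refine (Finset.prod_le_prod (fun j _ => abs_nonneg _) (fun j _ => hk j)).trans (le_of_eq ?_)
  rw [Finset.prod_mul_distrib, Finset.prod_mul_distrib, ← Real.rpow_sum_of_pos hy0,
    Finset.sum_sub_distrib, Finset.sum_neg_distrib]
end
end

section
/- Fix p ∈ ℕ and c > 1, and set c_− := 1 − c^{−1}, c_+ := 1 + c^{−1}. If x = (x_1,…,x_{2p}) ∈ ℝ^{2p} does not belong to W, then for every j = 2,…,2p: c_−|x̄_{j−1}| ≤ |x̄_j| ≤ c_+|x̄_{j−1}|. In particular, if x_1 ≠ 0 then x̄_j ≠ 0 for all j = 1,…,2p. -/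
open MeasureTheory Real Filter Asymptotics Set Finset Topology

noncomputable section

/-- key inequality (21): if `x ∉ W` then
`c_- |x̄_{j-1}| ≤ |x̄_j| ≤ c_+ |x̄_{j-1}|` for `j = 2,…,2p`; in particular `x_1 ≠ 0`
implies `x̄_j ≠ 0` for all `j = 1,…,2p`. -/
theorem stmt13 (p : ℕ) (hp : 0 < p) (c : ℝ) (hc : 1 < c) (x : Fin (2 * p) → ℝ)
    (hx : x ∉ W p c) :
    (∀ j : ℕ, 2 ≤ j → j ≤ 2 * p →
        (1 - c⁻¹) * |psum x (j - 1)| ≤ |psum x j| ∧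
          |psum x j| ≤ (1 + c⁻¹) * |psum x (j - 1)|) ∧
      (xval x 0 ≠ 0 → ∀ j : ℕ, 1 ≤ j → j ≤ 2 * p → psum x j ≠ 0) := by
  have key : ∀ j : ℕ, 2 ≤ j → j ≤ 2 * p →
        (1 - c⁻¹) * |psum x (j - 1)| ≤ |psum x j| ∧
          |psum x j| ≤ (1 + c⁻¹) * |psum x (j - 1)| := by
    intro j h2 hj
    obtain ⟨k, rfl⟩ : ∃ k, j = k + 2 := ⟨j - 2, by omega⟩
    have hW : c * |xval x (k + 1)| < |psum x (k + 1)| := by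
      by_contra hcon
      apply hx
      refine Set.mem_iUnion.2 ⟨⟨k, by omega⟩, ?_⟩
      have hk : k + 1 < 2 * p := by omega
      simp only [Wset, hk, if_true, Set.mem_setOf_eq]
      exact not_lt.1 hcon
    have hs : psum x (k + 2) = psum x (k + 1) + xval x (k + 1) := by
      unfold psum xval
      exact Finset.sum_range_succ _ (k + 1)
    have hv : |xval x (k + 1)| ≤ c⁻¹ * |psum x (k + 1)| := by
      rw [inv_mul_eq_div, le_div_iff₀ (by linarith)]
      linarith
    have e : k + 2 - 1 = k + 1 := by omega
    rw [e, hs]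
    constructor
    · have := abs_sub_abs_le_abs_sub (psum x (k + 1)) (-xval x (k + 1))
      rw [abs_neg, sub_neg_eq_add] at this
      linarith
    · have := abs_add_le (psum x (k + 1)) (xval x (k + 1))
      linarith
  refine ⟨key, ?_⟩
  intro h0 j h1
  induction j, h1 using Nat.le_induction with
  | base =>
    intro _
    simpa [psum, xval] using h0
  | succ n hn ih =>
    intro hj
    have h := (key (n + 1) (by omega) hj).1
    rw [Nat.add_sub_cancel] at h
    have hpos : 0 < |psum x n| := abs_pos.2 (ih (by omega))
    have hcm : 0 < 1 - c⁻¹ := sub_pos.2 (inv_lt_one_of_one_lt₀ hc)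
    exact abs_pos.1 (lt_of_lt_of_le (mul_pos hcm hpos) h)
end
end
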